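/- Let f ∈ 𝓒 and θ₀ < θ₁ be real numbers, and define LD_n(π,t) := (1/n) ∑_{i=1}^n f(i/n, π(i)/n) − μ_{f,t}[f]. Then the test based on the root of LD_n is consistent for testing θ = θ₀ against θ = θ₁: lim_{n→∞} Q_{n,f,θ₀}({π : there exists t with LD_n(π,t) = 0 and t > (θ₀+θ₁)/2}) = 0 and lim_{n→∞} Q_{n,f,θ₁}({π : there exists t with LD_n(π,t) = 0 and t ≤ (θ₀+θ₁)/2}) = 0. -/

import Mathlib

open MeasureTheory Filter Topology
open scoped ENNReal

noncomputable section

/-- The unit square `[0,1]²` in `ℝ × ℝ`. -/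
def unitSq : Set (ℝ × ℝ) := Set.Icc 0 1 ×ˢ Set.Icc 0 1

/-- Lebesgue measure restricted to `[0,1]`. -/
def unif01 : Measure ℝ := volume.restrict (Set.Icc 0 1)

/-- Lebesgue (uniform) measure on the unit square. -/
def usq : Measure (ℝ × ℝ) := unif01.prod unif01

/-- `𝓜`: Borel probability measures on `[0,1]²` with both marginals Lebesgue on `[0,1]`. -/
def MM : Set (Measure (ℝ × ℝ)) :=
  {μ | IsProbabilityMeasure μ ∧ μ.map Prod.fst = unif01 ∧ μ.map Prod.snd = unif01}

/-- The class `𝓒` of continuous functions on the unit square, not identically zero,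
with all row and column integrals vanishing. -/
def memC (f : ℝ × ℝ → ℝ) : Prop :=
  ContinuousOn f unitSq ∧ (∃ p ∈ unitSq, f p ≠ 0) ∧
    (∀ x ∈ Set.Icc (0 : ℝ) 1, (∫ z in (0 : ℝ)..1, f (x, z)) = 0) ∧
    (∀ y ∈ Set.Icc (0 : ℝ) 1, (∫ z in (0 : ℝ)..1, f (z, y)) = 0)

open scoped Classical in
/-- Kullback–Leibler divergence `D(μ‖ν)`, equal to `∫ log(dμ/dν) dμ` when `μ ≪ ν`
(and this integral exists), and `+∞` otherwise. -/
def KL (μ ν : Measure (ℝ × ℝ)) : ℝ≥0∞ :=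
  if μ ≪ ν ∧ Integrable (fun x => Real.log ((μ.rnDeriv ν x).toReal)) μ then
    ENNReal.ofReal (∫ x, Real.log ((μ.rnDeriv ν x).toReal) ∂μ)
  else ⊤

/-- The objective `θ μ[f] − D(μ‖u)`, as an extended real. -/
def objE (f : ℝ × ℝ → ℝ) (θ : ℝ) (μ : Measure (ℝ × ℝ)) : EReal :=
  ((θ * ∫ p, f p ∂μ : ℝ) : EReal) - (KL μ usq : EReal)

/-- `∑_{i=1}^n f(i/n, π(i)/n)`. -/
def permStat (f : ℝ × ℝ → ℝ) (n : ℕ) (π : Equiv.Perm (Fin n)) : ℝ :=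
  ∑ i : Fin n, f ((i.1 + 1 : ℝ) / n, ((π i).1 + 1 : ℝ) / n)

/-- The log normalizing constant `Z_n(f,θ)`. -/
def Zn (f : ℝ × ℝ → ℝ) (θ : ℝ) (n : ℕ) : ℝ :=
  Real.log (∑ π : Equiv.Perm (Fin n), Real.exp (θ * permStat f n π))

open scoped Classical in
/-- The probability that a sample from `Q_{n,f,θ}` satisfies `p`. -/
def Qprob (f : ℝ × ℝ → ℝ) (θ : ℝ) (n : ℕ) (p : Equiv.Perm (Fin n) → Prop) : ℝ :=
  ∑ π : Equiv.Perm (Fin n), if p π then Real.exp (θ * permStat f n π - Zn f θ n) else 0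

open scoped BoundedContinuousFunction

instance : IsProbabilityMeasure unif01 := ⟨by simp [unif01]⟩

instance : IsProbabilityMeasure usq := by unfold usq; infer_instance

lemma measurableSet_unitSq : MeasurableSet unitSq := measurableSet_Icc.prod measurableSet_Icc

lemma isCompact_unitSq : IsCompact unitSq := isCompact_Icc.prod isCompact_Icc

lemma usq_eq_restrict : usq = volume.restrict unitSq := by
  rw [usq, unif01, unitSq, Measure.prod_restrict, Measure.volume_eq_prod]

lemma unif01_compl : unif01 (Set.Icc 0 1)ᶜ = 0 := by
  simp [unif01, Measure.restrict_apply measurableSet_Icc.compl]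

lemma compl_unitSq_of_mem_MM {μ : Measure (ℝ × ℝ)} (hμ : μ ∈ MM) : μ unitSqᶜ = 0 := by
  obtain ⟨-, h1, h2⟩ := hμ
  have e1 : μ (Prod.fst ⁻¹' (Set.Icc 0 1)ᶜ) = 0 := by
    rw [← Measure.map_apply measurable_fst measurableSet_Icc.compl, h1, unif01_compl]
  have e2 : μ (Prod.snd ⁻¹' (Set.Icc 0 1)ᶜ) = 0 := by
    rw [← Measure.map_apply measurable_snd measurableSet_Icc.compl, h2, unif01_compl]
  refine measure_mono_null (fun p hp => ?_) (measure_union_null e1 e2)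
  by_contra h
  simp only [Set.mem_union, Set.mem_preimage, Set.mem_compl_iff, not_or, not_not] at h
  exact hp ⟨h.1, h.2⟩

lemma integral_eq_of_eqOn_unitSq {f : ℝ × ℝ → ℝ} {F : (ℝ × ℝ) →ᵇ ℝ}
    (hfF : Set.EqOn f F unitSq) {μ : Measure (ℝ × ℝ)} (hμ : μ ∈ MM) :
    ∫ p, f p ∂μ = ∫ p, F p ∂μ :=
  integral_congr_ae ((ae_iff.2 (compl_unitSq_of_mem_MM hμ)).mono fun _ hp => hfF hp)

/-- Boundedness and measurability of a function on the line. -/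
def BddMeas (a : ℝ → ℝ) : Prop := Measurable a ∧ ∃ C, ∀ x, |a x| ≤ C

lemma BddMeas.integrable {a : ℝ → ℝ} (ha : BddMeas a) (μ : Measure ℝ) [IsFiniteMeasure μ] :
    Integrable a μ := by
  obtain ⟨hm, C, hC⟩ := ha
  exact .of_bound hm.aestronglyMeasurable C (ae_of_all _ hC)

/-- The log-density `G + a ⊕ b`. -/
def logDens (G : ℝ × ℝ → ℝ) (a b : ℝ → ℝ) (p : ℝ × ℝ) : ℝ := G p + a p.1 + b p.2

/-- Measures with density `exp (G + a ⊕ b)` with respect to the uniform measure. -/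
def IsGibbs (G : (ℝ × ℝ) →ᵇ ℝ) (ν : Measure (ℝ × ℝ)) : Prop :=
  ∃ a b, BddMeas a ∧ BddMeas b ∧
    ν = usq.withDensity fun p => ENNReal.ofReal (Real.exp (logDens G a b p))

section logDens

variable (G : (ℝ × ℝ) →ᵇ ℝ) {a b : ℝ → ℝ}

lemma measurable_logDens (ha : BddMeas a) (hb : BddMeas b) : Measurable (logDens G a b) :=
  (G.continuous.measurable.add (ha.1.comp measurable_fst)).add (hb.1.comp measurable_snd)

lemma exists_logDens_bound (ha : BddMeas a) (hb : BddMeas b) :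
    ∃ C, ∀ p, |logDens G a b p| ≤ C := by
  obtain ⟨-, A, hA⟩ := ha
  obtain ⟨-, B, hB⟩ := hb
  refine ⟨‖G‖ + A + B, fun p => ?_⟩
  exact (abs_add_three _ _ _).trans
    (add_le_add (add_le_add (G.norm_coe_le_norm p) (hA _)) (hB _))

lemma integrable_logDens (ha : BddMeas a) (hb : BddMeas b) (μ : Measure (ℝ × ℝ))
    [IsFiniteMeasure μ] : Integrable (logDens G a b) μ := by
  obtain ⟨C, hC⟩ := exists_logDens_bound G ha hb
  exact .of_bound (measurable_logDens G ha hb).aestronglyMeasurable C (ae_of_all _ hC)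

lemma integrable_exp_logDens (ha : BddMeas a) (hb : BddMeas b) (μ : Measure (ℝ × ℝ))
    [IsFiniteMeasure μ] : Integrable (fun p => Real.exp (logDens G a b p)) μ := by
  obtain ⟨C, hC⟩ := exists_logDens_bound G ha hb
  refine .of_bound (measurable_logDens G ha hb).exp.aestronglyMeasurable (Real.exp C)
    (ae_of_all _ fun p => ?_)
  rw [Real.norm_eq_abs, Real.abs_exp, Real.exp_le_exp]
  exact (le_abs_self _).trans (hC p)

lemma integral_logDens_of_mem_MM (ha : BddMeas a) (hb : BddMeas b) {μ : Measure (ℝ × ℝ)}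
    (hμ : μ ∈ MM) :
    ∫ p, logDens G a b p ∂μ = ∫ p, G p ∂μ + ∫ x, a x ∂unif01 + ∫ y, b y ∂unif01 := by
  obtain ⟨hp, h1, h2⟩ := hμ
  have ia : Integrable (fun p : ℝ × ℝ => a p.1) μ := by
    have := ha.integrable (μ.map Prod.fst)
    exact this.comp_measurable measurable_fst
  have ib : Integrable (fun p : ℝ × ℝ => b p.2) μ := by
    have := hb.integrable (μ.map Prod.snd)
    exact this.comp_measurable measurable_snd
  have iG : Integrable G μ := G.integrable μ
  simp only [logDens]
  rw [integral_add (f := fun p => G p + a p.1) (iG.add ia) ib, integral_add iG ia]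
  congr 1
  · congr 1
    rw [← h1, integral_map measurable_fst.aemeasurable ha.1.aestronglyMeasurable]
  · rw [← h2, integral_map measurable_snd.aemeasurable hb.1.aestronglyMeasurable]

lemma withDensity_logDens_eq_tilted (ha : BddMeas a) (hb : BddMeas b) {ν : Measure (ℝ × ℝ)}
    [IsProbabilityMeasure ν]
    (hν : ν = usq.withDensity fun p => ENNReal.ofReal (Real.exp (logDens G a b p))) :
    (∫ p, Real.exp (logDens G a b p) ∂usq) = 1 ∧ ν = usq.tilted (logDens G a b) := by
  have h1 : ∫ p, Real.exp (logDens G a b p) ∂usq = 1 := by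
    have h : ν Set.univ = 1 := measure_univ
    rw [hν, withDensity_apply _ MeasurableSet.univ, Measure.restrict_univ,
      ← ofReal_integral_eq_lintegral_ofReal (integrable_exp_logDens G ha hb usq)
        (ae_of_all _ fun p => (Real.exp_pos _).le)] at h
    simpa using h
  refine ⟨h1, ?_⟩
  rw [hν, Measure.tilted, h1]
  simp

end logDens

/-- A measure of the exponential product form with the right marginals is the only maximizer. -/
lemma IsGibbs.eq_of_objE_le {F : (ℝ × ℝ) →ᵇ ℝ} {f : ℝ × ℝ → ℝ} {t : ℝ}
    (hfF : Set.EqOn f F unitSq) {ν m : Measure (ℝ × ℝ)} (hG : IsGibbs (t • F) ν) (hν : ν ∈ MM)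
    (hm : m ∈ MM) (hle : objE f t ν ≤ objE f t m) : m = ν := by
  obtain ⟨a, b, ha, hb, hd⟩ := hG
  have hνp := hν.1
  have hmp := hm.1
  obtain ⟨hI, htl⟩ := withDensity_logDens_eq_tilted (t • F) ha hb hd
  set r := logDens ⇑(t • F) a b with hr
  have hexp := integrable_exp_logDens (t • F) ha hb usq
  have hrint : ∀ {μ : Measure (ℝ × ℝ)}, μ ∈ MM →
      ∫ p, r p ∂μ = t * ∫ p, f p ∂μ + ∫ x, a x ∂unif01 + ∫ y, b y ∂unif01 := by
    intro μ hμ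
    rw [integral_eq_of_eqOn_unitSq hfF hμ, hr, integral_logDens_of_mem_MM (t • F) ha hb hμ]
    simp [integral_const_mul]
  have hac : ν ≪ usq := htl ▸ tilted_absolutelyContinuous _ _
  have hac' : usq ≪ ν := htl ▸ absolutelyContinuous_tilted hexp
  have hllr : (fun x => Real.log ((ν.rnDeriv usq x).toReal)) =ᵐ[ν] r := by
    have h := log_rnDeriv_tilted_left_self hexp
    rw [← hr, ← htl] at h
    filter_upwards [hac.ae_le h] with x hx
    rw [hx, hI]; simp
  have hllrint : Integrable (llr ν usq) ν :=
    (integrable_congr hllr).2 (integrable_logDens (t • F) ha hb ν)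
  have hKLν : KL ν usq = ENNReal.ofReal (∫ p, r p ∂ν) := by
    rw [KL, if_pos ⟨hac, hllrint⟩, integral_congr_ae hllr]
  have hnn : ∀ {μ ρ : Measure (ℝ × ℝ)} [IsProbabilityMeasure μ] [IsProbabilityMeasure ρ],
      μ ≪ ρ → Integrable (llr μ ρ) μ → 0 ≤ ∫ p, llr μ ρ p ∂μ := by
    intro μ ρ _ _ h1 h2
    simpa using InformationTheory.integral_llr_add_sub_measure_univ_nonneg h1 h2
  have hrnn : 0 ≤ ∫ p, r p ∂ν := by
    have := hnn hac hllrint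
    rwa [show ∫ p, llr ν usq p ∂ν = ∫ p, r p ∂ν from integral_congr_ae hllr] at this
  have coe_obj : ∀ {x y : ℝ}, 0 ≤ y →
      (x : EReal) - ((ENNReal.ofReal y : ℝ≥0∞) : EReal) = ((x - y : ℝ) : EReal) := by
    intro x y hy
    rw [EReal.coe_ennreal_ofReal, max_eq_left hy, EReal.coe_sub]
  rw [objE, objE, hKLν, coe_obj hrnn] at hle
  by_cases hk : m ≪ usq ∧ Integrable (fun x => Real.log ((m.rnDeriv usq x).toReal)) m
  · rw [KL, if_pos hk] at hle
    have hmint : Integrable (llr m usq) m := hk.2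
    change _ ≤ _ - ((ENNReal.ofReal (∫ p, llr m usq p ∂m) : ℝ≥0∞) : EReal) at hle
    rw [coe_obj (hnn hk.1 hmint), EReal.coe_le_coe_iff] at hle
    have hrm := integrable_logDens (t • F) ha hb m
    have h1 := integral_llr_tilted_right hk.1 hrm hexp hmint
    have h2 := integrable_llr_tilted_right hk.1 hrm hmint hexp
    rw [← hr, ← htl] at h1 h2
    rw [hI, hrint hm] at h1
    rw [hrint hν] at hle
    have hmν : m ≪ ν := hk.1.trans hac'
    rw [← InformationTheory.klDiv_eq_zero_iff,
      InformationTheory.klDiv_of_ac_of_integrable hmν h2, h1]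
    simp only [Real.log_one, probReal_univ, ENNReal.ofReal_eq_zero]
    linarith
  · rw [KL, if_neg hk] at hle
    rw [EReal.coe_ennreal_top, EReal.sub_top, le_bot_iff] at hle
    exact absurd hle (EReal.coe_ne_bot _)

/-- If `μ` is the first marginal of `exp H • (α ⊗ β)` with `H` bounded, then `α` has a bounded
log-density with respect to `μ`. -/
lemma exists_withDensity_eq_of_marginal {α β μ : Measure ℝ} [IsProbabilityMeasure β]
    {H : ℝ × ℝ → ℝ} (hH : Measurable H) {C : ℝ} (hC : ∀ p, |H p| ≤ C)
    (h : ∀ s, MeasurableSet s →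
      μ s = ∫⁻ x in s, ∫⁻ y, ENNReal.ofReal (Real.exp (H (x, y))) ∂β ∂α) :
    ∃ a, BddMeas a ∧ μ.withDensity (fun x => ENNReal.ofReal (Real.exp (a x))) = α := by
  set A : ℝ → ℝ := fun x => ∫ y, Real.exp (H (x, y)) ∂β with hA
  have hint : ∀ x, Integrable (fun y => Real.exp (H (x, y))) β := fun x => by
    refine .of_bound (hH.comp measurable_prodMk_left).exp.aestronglyMeasurable (Real.exp C)
      (ae_of_all _ fun y => ?_)
    rw [Real.norm_eq_abs, Real.abs_exp, Real.exp_le_exp]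
    exact (le_abs_self _).trans (hC _)
  have hAm : Measurable A := by
    have : StronglyMeasurable fun p : ℝ × ℝ => Real.exp (H p) := hH.exp.stronglyMeasurable
    exact this.integral_prod_right'.measurable
  have hle : ∀ x, A x ≤ Real.exp C := fun x => by
    have := integral_mono (hint x) (integrable_const (Real.exp C)) fun y =>
      Real.exp_le_exp.2 ((le_abs_self _).trans (hC (x, y)))
    simpa using this
  have hge : ∀ x, Real.exp (-C) ≤ A x := fun x => by
    have := integral_mono (integrable_const (Real.exp (-C))) (hint x) fun y =>
      Real.exp_le_exp.2 (neg_le_of_abs_le (hC (x, y)))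
    simpa using this
  have hpos : ∀ x, 0 < A x := fun x => (Real.exp_pos _).trans_le (hge x)
  have hμ : μ = α.withDensity fun x => ENNReal.ofReal (A x) := by
    ext s hs
    rw [h s hs, withDensity_apply _ hs]
    refine lintegral_congr fun x => ?_
    rw [hA, ofReal_integral_eq_lintegral_ofReal (hint x) (ae_of_all _ fun y => (Real.exp_pos _).le)]
  refine ⟨fun x => -Real.log (A x), ⟨hAm.log.neg, C, fun x => ?_⟩, ?_⟩
  · rw [abs_neg, abs_le]
    exact ⟨(Real.le_log_iff_exp_le (hpos x)).2 (hge x), (Real.log_le_iff_le_exp (hpos x)).2 (hle x)⟩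
  · have := withDensity_inv_same (μ := α) (f := fun x => ENNReal.ofReal (A x)) hAm.ennreal_ofReal
      (ae_of_all _ fun x => by simpa using hpos x) (ae_of_all _ fun x => ENNReal.ofReal_ne_top)
    rw [← hμ] at this
    convert this using 3 with x
    rw [Real.exp_neg, Real.exp_log (hpos x), ENNReal.ofReal_inv_of_pos (hpos x)]

/-- A measure in `𝓜` that becomes a product measure after multiplication by `exp (-G)` is of the
exponential product form. -/
lemma isGibbs_of_factorization (G : (ℝ × ℝ) →ᵇ ℝ) {ν : Measure (ℝ × ℝ)} (hν : ν ∈ MM)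
    (h : ∀ φ ψ : ℝ →ᵇ ℝ, (∫ p, Real.exp (-G p) * (φ p.1 * ψ p.2) ∂ν) * ∫ p, Real.exp (-G p) ∂ν =
      (∫ p, Real.exp (-G p) * φ p.1 ∂ν) * ∫ p, Real.exp (-G p) * ψ p.2 ∂ν) :
    IsGibbs G ν := by
  obtain ⟨hp, hν1, hν2⟩ := hν
  have bd : ∀ {b : ℝ × ℝ → ℝ} (ρ : Measure (ℝ × ℝ)) [IsFiniteMeasure ρ], Measurable b →
      (∀ p, |b p| ≤ ‖G‖) → Integrable (fun p => Real.exp (b p)) ρ := by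
    intro b ρ _ hb hbd
    refine .of_bound hb.exp.aestronglyMeasurable (Real.exp ‖G‖) (ae_of_all _ fun p => ?_)
    rw [Real.norm_eq_abs, Real.abs_exp, Real.exp_le_exp]
    exact (le_abs_self _).trans (hbd p)
  have hGm : Measurable G := G.continuous.measurable
  have hneg : Integrable (fun p => Real.exp ((-G) p)) ν :=
    bd ν hGm.neg fun p => by simpa using G.norm_coe_le_norm p
  set τ := ν.tilted ⇑(-G) with hτ
  have hτp : IsProbabilityMeasure τ := isProbabilityMeasure_tilted hneg
  have hZ : 0 < ∫ p, Real.exp (-G p) ∂ν := integral_exp_pos hneg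
  have hτint : ∀ g : ℝ × ℝ → ℝ, ∫ p, g p ∂τ =
      (∫ p, Real.exp (-G p) * g p ∂ν) / ∫ p, Real.exp (-G p) ∂ν := by
    intro g
    rw [hτ, integral_tilted, ← integral_div]
    refine integral_congr_ae (ae_of_all _ fun p => ?_)
    simp only [BoundedContinuousFunction.coe_neg, Pi.neg_apply, smul_eq_mul]
    ring
  set α := τ.map Prod.fst with hα
  set β := τ.map Prod.snd with hβ
  have hαp : IsProbabilityMeasure α := Measure.isProbabilityMeasure_map measurable_fst.aemeasurable
  have hβp : IsProbabilityMeasure β := Measure.isProbabilityMeasure_map measurable_snd.aemeasurable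
  have hprod : τ = α.prod β := by
    refine Measure.eq_prod_of_integral_mul_boundedContinuousFunction fun φ ψ => ?_
    rw [hα, hβ, integral_map measurable_fst.aemeasurable φ.continuous.aestronglyMeasurable,
      integral_map measurable_snd.aemeasurable ψ.continuous.aestronglyMeasurable,
      hτint, hτint, hτint, div_mul_div_comm, ← h φ ψ]
    field_simp
  have hντ : ν = τ.tilted G := by
    have := tilted_neg_same hneg
    rw [← hτ, BoundedContinuousFunction.coe_neg, neg_neg] at this
    exact this.symm
  have hGint : Integrable (fun p => Real.exp (G p)) τ :=
    bd τ hGm fun p => by simpa using G.norm_coe_le_norm p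
  set l := Real.log (∫ p, Real.exp (G p) ∂τ) with hl
  set H : ℝ × ℝ → ℝ := fun p => G p - l with hH
  have hHm : Measurable H := hGm.sub_const l
  have hHb : ∀ p, |H p| ≤ ‖G‖ + |l| := fun p =>
    (abs_sub _ _).trans (add_le_add_left (G.norm_coe_le_norm p) _)
  have hνH : ν = (α.prod β).withDensity fun p => ENNReal.ofReal (Real.exp (H p)) := by
    rw [← hprod, hντ, Measure.tilted]
    simp only [hH, Real.exp_sub, hl, Real.exp_log (integral_exp_pos hGint)]
  have hHme : Measurable fun p => ENNReal.ofReal (Real.exp (H p)) := hHm.exp.ennreal_ofReal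
  obtain ⟨a, ha, haα⟩ := exists_withDensity_eq_of_marginal (α := α) (β := β) (μ := unif01) hHm hHb
    (by
      intro s hs
      rw [← hν1, Measure.map_apply measurable_fst hs, hνH,
        withDensity_apply _ (measurable_fst hs), ← Set.prod_univ, ← Measure.prod_restrict,
        Measure.restrict_univ, lintegral_prod _ hHme.aemeasurable])
  obtain ⟨b, hb, hbβ⟩ := exists_withDensity_eq_of_marginal (α := β) (β := α) (μ := unif01)
    (H := H ∘ Prod.swap) (hHm.comp measurable_swap) (fun p => hHb _)
    (by
      intro s hs
      rw [← hν2, Measure.map_apply measurable_snd hs, hνH,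
        withDensity_apply _ (measurable_snd hs), ← Set.univ_prod, ← Measure.prod_restrict,
        Measure.restrict_univ, lintegral_prod_symm _ hHme.aemeasurable]
      rfl)
  have hb' : BddMeas fun y => b y - l := by
    obtain ⟨hm, C, hC⟩ := hb
    exact ⟨hm.sub_const l, C + |l|, fun x => (abs_sub _ _).trans (add_le_add_left (hC x) _)⟩
  refine ⟨a, _, ha, hb', ?_⟩
  rw [hνH, ← haα, ← hbβ, prod_withDensity (by have := ha.1; fun_prop) (by have := hb.1; fun_prop),
    ← withDensity_mul _ (by have := ha.1; have := hb.1; fun_prop) hHme, usq]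
  congr 1
  ext p
  simp only [Pi.mul_apply, logDens, hH]
  rw [← ENNReal.ofReal_mul (Real.exp_pos _).le, ← ENNReal.ofReal_mul (by positivity),
    ← Real.exp_add, ← Real.exp_add]
  congr 2
  ring

lemma usq_mem_MM : usq ∈ MM := by
  refine ⟨inferInstance, ?_, ?_⟩ <;> simp [usq]

lemma KL_usq_self_ne_top : KL usq usq ≠ ⊤ := by
  have h := llr_self usq
  rw [KL, if_pos ⟨Measure.AbsolutelyContinuous.rfl, (integrable_congr h).2 (integrable_zero _ _ _)⟩]
  exact ENNReal.ofReal_ne_top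

lemma ae_unif01_mem : ∀ᵐ x ∂unif01, x ∈ Set.Icc (0 : ℝ) 1 := unif01_compl

lemma integral_unif01 (g : ℝ → ℝ) : ∫ x, g x ∂unif01 = ∫ x in (0 : ℝ)..1, g x := by
  rw [unif01, integral_Icc_eq_integral_Ioc, intervalIntegral.integral_of_le zero_le_one]

lemma integrable_mul_bdd {F : (ℝ × ℝ) →ᵇ ℝ} {g : ℝ × ℝ → ℝ} (hg : Integrable g usq) :
    Integrable (fun p => g p * F p) usq :=
  hg.mul_bdd (c := ‖F‖) F.continuous.aestronglyMeasurable (ae_of_all _ F.norm_coe_le_norm)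

/-- The tilting parameter of an exponential product measure is determined by the measure. -/
lemma IsGibbs.param_unique {f : ℝ × ℝ → ℝ} (hf : memC f) {F : (ℝ × ℝ) →ᵇ ℝ}
    (hfF : Set.EqOn f F unitSq) {ν : Measure (ℝ × ℝ)} [IsProbabilityMeasure ν] {s t : ℝ}
    (hs : IsGibbs (s • F) ν) (ht : IsGibbs (t • F) ν) : s = t := by
  obtain ⟨hfc, ⟨p₀, hp₀, hfp₀⟩, hrow, hcol⟩ := hf
  obtain ⟨a, b, ha, hb, hs⟩ := hs
  obtain ⟨a', b', ha', hb', ht⟩ := ht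
  by_contra hne
  obtain ⟨h1, h1'⟩ := withDensity_logDens_eq_tilted (s • F) ha hb hs
  obtain ⟨h2, h2'⟩ := withDensity_logDens_eq_tilted (t • F) ha' hb' ht
  have l1 := log_rnDeriv_tilted_left_self (integrable_exp_logDens (s • F) ha hb usq)
  have l2 := log_rnDeriv_tilted_left_self (integrable_exp_logDens (t • F) ha' hb' usq)
  rw [← h1', h1] at l1
  rw [← h2', h2] at l2
  have hae : ∀ᵐ p ∂usq, (s - t) * F p + (a p.1 - a' p.1) + (b p.2 - b' p.2) = 0 := by
    filter_upwards [l1, l2] with p e1 e2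
    have := e1.symm.trans e2
    simp only [logDens, BoundedContinuousFunction.coe_smul, smul_eq_mul, Real.log_one] at this
    linarith
  have hA : Integrable (fun p : ℝ × ℝ => (a p.1 - a' p.1) * F p) usq :=
    integrable_mul_bdd (((ha.integrable unif01).sub (ha'.integrable unif01)).comp_fst unif01)
  have hB : Integrable (fun p : ℝ × ℝ => (b p.2 - b' p.2) * F p) usq :=
    integrable_mul_bdd (((hb.integrable unif01).sub (hb'.integrable unif01)).comp_snd unif01)
  have hFF : Integrable (fun p : ℝ × ℝ => F p * F p) usq := integrable_mul_bdd (F.integrable usq)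
  have iA : ∫ p, (a p.1 - a' p.1) * F p ∂usq = 0 := by
    rw [usq, integral_prod _ hA]
    refine integral_eq_zero_of_ae ?_
    filter_upwards [ae_unif01_mem] with x hx
    rw [integral_const_mul, Pi.zero_apply, ← hrow x hx, ← integral_unif01]
    have : ∫ y, F (x, y) ∂unif01 = ∫ y, f (x, y) ∂unif01 := by
      refine integral_congr_ae ?_
      filter_upwards [ae_unif01_mem] with y hy
      exact (hfF ⟨hx, hy⟩).symm
    rw [this, integral_unif01, hrow x hx, mul_zero]
  have iB : ∫ p, (b p.2 - b' p.2) * F p ∂usq = 0 := by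
    rw [usq, integral_prod_symm _ hB]
    refine integral_eq_zero_of_ae ?_
    filter_upwards [ae_unif01_mem] with y hy
    have : ∫ x, F (x, y) ∂unif01 = ∫ x, f (x, y) ∂unif01 := by
      refine integral_congr_ae ?_
      filter_upwards [ae_unif01_mem] with x hx
      exact (hfF ⟨hx, hy⟩).symm
    rw [integral_const_mul, Pi.zero_apply, this, integral_unif01, hcol y hy, mul_zero]
  have hsum : (s - t) * ∫ p, F p * F p ∂usq = 0 := by
    have h0 : ∫ p, ((s - t) * (F p * F p) + (a p.1 - a' p.1) * F p + (b p.2 - b' p.2) * F p) ∂usq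
        = 0 := by
      refine integral_eq_zero_of_ae ?_
      filter_upwards [hae] with p hp
      rw [Pi.zero_apply]
      linear_combination F p * hp
    rw [integral_add (f := fun p => (s - t) * (F p * F p) + (a p.1 - a' p.1) * F p)
      ((hFF.const_mul _).add hA) hB, integral_add (hFF.const_mul _) hA, iA, iB,
      integral_const_mul] at h0
    linarith
  have hzero : ∫ p, F p * F p ∂usq = 0 :=
    (mul_eq_zero.1 hsum).resolve_left (sub_ne_zero.2 hne)
  have hF0 : (fun p => F p) =ᵐ[volume.restrict unitSq] fun _ => (0 : ℝ) := by
    rw [← usq_eq_restrict]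
    filter_upwards [(integral_eq_zero_iff_of_nonneg (fun p => mul_self_nonneg (F p)) hFF).1 hzero]
      with p hp
    exact mul_self_eq_zero.1 hp
  have hcl : unitSq ⊆ closure (interior unitSq) := by
    rw [unitSq, interior_prod_eq, closure_prod_eq, interior_Icc, closure_Ioo zero_ne_one]
  have := Measure.eqOn_of_ae_eq hF0 F.continuous.continuousOn continuousOn_const hcl hp₀
  exact hfp₀ ((hfF hp₀).trans this)

/-- The mean value of `f` under the maximizer is strictly increasing in the parameter. -/
lemma strictMono_integral_maximizer {f : ℝ × ℝ → ℝ} (hf : memC f) {F : (ℝ × ℝ) →ᵇ ℝ}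
    (hfF : Set.EqOn f F unitSq) {μf : ℝ → Measure (ℝ × ℝ)}
    (hμf : ∀ t : ℝ, μf t ∈ MM ∧ ∀ ν ∈ MM, objE f t ν ≤ objE f t (μf t))
    (hG : ∀ t, IsGibbs (t • F) (μf t)) : StrictMono fun t => ∫ p, f p ∂(μf t) := by
  have hfin : ∀ t, KL (μf t) usq ≠ ⊤ := by
    intro t ht
    have h := (hμf t).2 usq usq_mem_MM
    rw [objE, objE, ht, EReal.coe_ennreal_top, EReal.sub_top, le_bot_iff,
      ← ENNReal.ofReal_toReal KL_usq_self_ne_top, EReal.coe_ennreal_ofReal, ← EReal.coe_sub] at h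
    exact EReal.coe_ne_bot _ h
  have hobj : ∀ s t, objE f s (μf t) =
      ((s * ∫ p, f p ∂(μf t) - (KL (μf t) usq).toReal : ℝ) : EReal) := by
    intro s t
    rw [objE, EReal.coe_sub, ← EReal.coe_ennreal_toReal (hfin t)]
  intro s t hst
  have h1 := (hμf s).2 _ (hμf t).1
  have h2 := (hμf t).2 _ (hμf s).1
  rw [hobj, hobj, EReal.coe_le_coe_iff] at h1 h2
  by_contra hlt
  have hle := not_lt.1 hlt
  have heq : objE f s (μf s) ≤ objE f s (μf t) := by
    rw [hobj, hobj, EReal.coe_le_coe_iff]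
    nlinarith
  have hst' := (hG s).eq_of_objE_le hfF (hμf s).1 (hμf t).1 heq
  have := (hμf t).1.1
  exact hst.ne ((hst' ▸ hG s).param_unique hf hfF (hG t))

section Swap

variable {ι : Type*} [Fintype ι]

lemma abs_sum_le_card_mul {h : ι → ι → ℝ} {M : ℝ} (hM : ∀ i j, |h i j| ≤ M)
    (π : Equiv.Perm ι) : |∑ k, h k (π k)| ≤ Fintype.card ι * M := by
  refine (Finset.abs_sum_le_sum_abs _ _).trans ((Finset.sum_le_sum fun k _ => hM k (π k)).trans ?_)
  simp

/-- The empirical factorization defect of a permutation under weights `e`. -/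
def swapDefect (e : ι → ι → ℝ) (φ ψ : ι → ℝ) (π : Equiv.Perm ι) : ℝ :=
  (∑ k, e k (π k) * (φ k * ψ (π k))) * ∑ k, e k (π k)
    - (∑ k, e k (π k) * φ k) * ∑ k, e k (π k) * ψ (π k)

lemma swapDefect_eq_sum (e : ι → ι → ℝ) (φ ψ : ι → ℝ) (π : Equiv.Perm ι) :
    swapDefect e φ ψ π =
      ∑ i, ∑ j, e i (π i) * e j (π j) * (φ i * (ψ (π i) - ψ (π j))) := by
  rw [swapDefect, Finset.sum_mul_sum, Finset.sum_mul_sum, ← Finset.sum_sub_distrib]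
  refine Finset.sum_congr rfl fun i _ => ?_
  rw [← Finset.sum_sub_distrib]
  exact Finset.sum_congr rfl fun j _ => by ring

variable [DecidableEq ι]

lemma abs_sum_mul_swap_sub_le {h : ι → ι → ℝ} {M : ℝ} (hM : ∀ i j, |h i j| ≤ M)
    (π : Equiv.Perm ι) (i j : ι) :
    |∑ k, h k ((π * Equiv.swap i j) k) - ∑ k, h k (π k)| ≤ 4 * M := by
  have hM0 : 0 ≤ M := (abs_nonneg _).trans (hM i i)
  rcases eq_or_ne i j with rfl | hij
  · simpa using hM0
  rw [← Finset.sum_sub_distrib, Fintype.sum_eq_add i j hij]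
  · have e1 := abs_le.1 (hM i (π j))
    have e2 := abs_le.1 (hM i (π i))
    have e3 := abs_le.1 (hM j (π i))
    have e4 := abs_le.1 (hM j (π j))
    simp only [Equiv.Perm.mul_apply, Equiv.swap_apply_left, Equiv.swap_apply_right]
    rw [abs_le]
    constructor <;> linarith
  · rintro k ⟨hki, hkj⟩
    simp [Equiv.swap_apply_of_ne_of_ne hki hkj]

lemma sum_mul_swap {h : ι → ι → ℝ} (π : Equiv.Perm ι) {i j : ι} (hij : i ≠ j) :
    ∑ k, h k ((π * Equiv.swap i j) k) - h i (π j) - h j (π i)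
      = ∑ k, h k (π k) - h i (π i) - h j (π j) := by
  have : ∑ k, h k ((π * Equiv.swap i j) k) - ∑ k, h k (π k) =
      h i (π j) - h i (π i) + (h j (π i) - h j (π j)) := by
    rw [← Finset.sum_sub_distrib, Fintype.sum_eq_add i j hij]
    · simp
    · rintro k ⟨hki, hkj⟩
      simp [Equiv.swap_apply_of_ne_of_ne hki hkj]
  linarith

lemma abs_swapDefect_sub_le {e : ι → ι → ℝ} {φ ψ : ι → ℝ} {M : ℝ} (h1 : 1 ≤ M)
    (he : ∀ i j, |e i j| ≤ M) (hφ : ∀ i, |φ i| ≤ M) (hψ : ∀ i, |ψ i| ≤ M)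
    (π : Equiv.Perm ι) (i j : ι) :
    |swapDefect e φ ψ π - swapDefect e φ ψ (π * Equiv.swap i j)|
      ≤ 16 * M ^ 6 * Fintype.card ι := by
  have hM0 : 0 ≤ M := zero_le_one.trans h1
  have key : ∀ {a a' b b' : ℝ}, |a' - a| ≤ 4 * M ^ 3 → |b' - b| ≤ 4 * M ^ 3 →
      |a| ≤ Fintype.card ι * M ^ 3 → |b'| ≤ Fintype.card ι * M ^ 3 →
      |a' * b' - a * b| ≤ 8 * M ^ 6 * Fintype.card ι := by
    intro a a' b b' h1 h2 h3 h4
    calc |a' * b' - a * b| = |(a' - a) * b' + a * (b' - b)| := by ring_nf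
      _ ≤ |a' - a| * |b'| + |a| * |b' - b| := by
        rw [← abs_mul, ← abs_mul]; exact abs_add_le _ _
      _ ≤ 4 * M ^ 3 * (Fintype.card ι * M ^ 3) + Fintype.card ι * M ^ 3 * (4 * M ^ 3) := by
        gcongr
      _ = _ := by ring
  have b1 : ∀ i j, |e i j * (φ i * ψ j)| ≤ M ^ 3 := by
    intro i j
    rw [abs_mul, abs_mul]
    calc _ ≤ M * (M * M) := by gcongr <;> simp [he, hφ, hψ]
      _ = _ := by ring
  have hM13 : M ≤ M ^ 3 := le_self_pow₀ h1 (by norm_num)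
  have hM23 : M * M ≤ M ^ 3 := by
    rw [← sq]; exact pow_le_pow_right₀ h1 (by norm_num)
  have b2 : ∀ i j, |e i j| ≤ M ^ 3 := fun i j => (he i j).trans hM13
  have b3 : ∀ i j, |e i j * φ i| ≤ M ^ 3 := fun i j => by
    rw [abs_mul]; exact (mul_le_mul (he i j) (hφ i) (abs_nonneg _) hM0).trans hM23
  have b4 : ∀ i j, |e i j * ψ j| ≤ M ^ 3 := fun i j => by
    rw [abs_mul]; exact (mul_le_mul (he i j) (hψ j) (abs_nonneg _) hM0).trans hM23
  have k1 := key (abs_sum_mul_swap_sub_le b1 π i j) (abs_sum_mul_swap_sub_le b2 π i j)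
    (abs_sum_le_card_mul b1 π) (abs_sum_le_card_mul b2 _)
  have k2 := key (abs_sum_mul_swap_sub_le b3 π i j) (abs_sum_mul_swap_sub_le b4 π i j)
    (abs_sum_le_card_mul b3 π) (abs_sum_le_card_mul b4 _)
  rw [abs_le] at k1 k2 ⊢
  unfold swapDefect
  constructor <;> linarith [k1.1, k1.2, k2.1, k2.2]

/-- Second moment bound for the factorization defect under a permutation Gibbs weight. -/
lemma sum_exp_mul_swapDefect_sq_le (g : ι → ι → ℝ) {φ ψ : ι → ℝ} {M : ℝ} (h1 : 1 ≤ M)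
    (he : ∀ i j, Real.exp (-g i j) ≤ M) (hφ : ∀ i, |φ i| ≤ M) (hψ : ∀ i, |ψ i| ≤ M) :
    ∑ π : Equiv.Perm ι, Real.exp (∑ k, g k (π k)) *
        swapDefect (fun i j => Real.exp (-g i j)) φ ψ π ^ 2
      ≤ 16 * M ^ 10 * Fintype.card ι ^ 3 * ∑ π : Equiv.Perm ι, Real.exp (∑ k, g k (π k)) := by
  have hM0 : 0 ≤ M := zero_le_one.trans h1
  set e : ι → ι → ℝ := fun i j => Real.exp (-g i j) with he_def
  have he' : ∀ i j, |e i j| ≤ M := fun i j => by rw [abs_of_pos (Real.exp_pos _)]; exact he i j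
  set w : Equiv.Perm ι → ℝ := fun π => Real.exp (∑ k, g k (π k)) with hw
  set T := swapDefect e φ ψ with hT
  let A : ι → ι → Equiv.Perm ι → ℝ := fun i j π =>
    w π * (e i (π i) * e j (π j) * (φ i * (ψ (π i) - ψ (π j))))
  have hA : ∀ i j π, A i j (π * Equiv.swap i j) = -A i j π := by
    intro i j π
    rcases eq_or_ne i j with rfl | hij
    · simp [A]
    have : w (π * Equiv.swap i j) * (e i (π j) * e j (π i)) =
        w π * (e i (π i) * e j (π j)) := by
      simp only [hw, he_def, ← Real.exp_add]
      congr 1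
      linarith [sum_mul_swap (h := g) π hij]
    simp only [A, Equiv.Perm.mul_apply, Equiv.swap_apply_left, Equiv.swap_apply_right]
      at this ⊢
    linear_combination (φ i * (ψ (π j) - ψ (π i))) * this
  have hAle : ∀ i j π, |A i j π| ≤ w π * (2 * M ^ 4) := by
    intro i j π
    have hψ2 : |ψ (π i) - ψ (π j)| ≤ 2 * M :=
      (abs_sub _ _).trans (by linarith [hψ (π i), hψ (π j)])
    simp only [A, abs_mul, abs_of_pos (Real.exp_pos _), hw]
    calc _ ≤ Real.exp (∑ k, g k (π k)) * (M * M * (M * (2 * M))) := by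
          gcongr <;> simp only [he', hφ]
      _ = _ := by ring
  have hpair : ∀ i j, ∑ π, A i j π * T π ≤ 16 * M ^ 10 * Fintype.card ι * ∑ π, w π := by
    intro i j
    have hsw : ∑ π, A i j π * T π = ∑ π, -(A i j π * T (π * Equiv.swap i j)) := by
      rw [← Equiv.sum_comp (Equiv.mulRight (Equiv.swap i j)) fun π => A i j π * T π]
      refine Finset.sum_congr rfl fun π _ => ?_
      rw [Equiv.coe_mulRight, hA, neg_mul]
    have h2 : 2 * ∑ π, A i j π * T π = ∑ π, A i j π * (T π - T (π * Equiv.swap i j)) := by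
      rw [two_mul]
      nth_rewrite 2 [hsw]
      rw [← Finset.sum_add_distrib]
      exact Finset.sum_congr rfl fun π _ => by ring
    have h3 : ∑ π, A i j π * (T π - T (π * Equiv.swap i j)) ≤
        ∑ π, w π * (2 * M ^ 4) * (16 * M ^ 6 * Fintype.card ι) := by
      refine Finset.sum_le_sum fun π _ => (le_abs_self _).trans ?_
      rw [abs_mul]
      exact mul_le_mul (hAle i j π) (abs_swapDefect_sub_le h1 he' hφ hψ π i j) (abs_nonneg _)
        (mul_nonneg (Real.exp_pos _).le (by positivity))
    rw [← h2, ← Finset.sum_mul, ← Finset.sum_mul] at h3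
    linarith
  calc ∑ π, w π * T π ^ 2 = ∑ π, ∑ i, ∑ j, A i j π * T π := by
        refine Finset.sum_congr rfl fun π _ => ?_
        simp only [A, ← Finset.sum_mul, ← Finset.mul_sum]
        rw [← swapDefect_eq_sum]
        ring
    _ = ∑ i, ∑ j, ∑ π, A i j π * T π := by
        rw [Finset.sum_comm]
        exact Finset.sum_congr rfl fun i _ => Finset.sum_comm
    _ ≤ ∑ _i : ι, ∑ _j : ι, 16 * M ^ 10 * Fintype.card ι * ∑ π, w π :=
        Finset.sum_le_sum fun i _ => Finset.sum_le_sum fun j _ => hpair i j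
    _ = _ := by
        simp only [Finset.sum_const, Finset.card_univ, nsmul_eq_mul]
        ring

end Swap

/-- The `i`-th grid point `(i + 1) / (n + 1)`. -/
def gridPt (n : ℕ) (i : Fin (n + 1)) : ℝ := (i.1 + 1 : ℝ) / (n + 1)

lemma gridPt_mem (n : ℕ) (i : Fin (n + 1)) : gridPt n i ∈ Set.Icc (0 : ℝ) 1 := by
  have : (i.1 : ℝ) + 1 ≤ n + 1 := by exact_mod_cast i.2
  exact ⟨by unfold gridPt; positivity, (div_le_one (by positivity)).2 this⟩

lemma tendsto_average_gridPt (φ : ℝ →ᵇ ℝ) :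
    Tendsto (fun n : ℕ => ((n : ℝ) + 1)⁻¹ * ∑ i, φ (gridPt n i)) atTop
      (𝓝 (∫ x, φ x ∂unif01)) := by
  rw [integral_unif01, Metric.tendsto_atTop]
  intro ε hε
  obtain ⟨δ, hδ, hu⟩ := Metric.uniformContinuousOn_iff.1
    ((isCompact_Icc (a := (0 : ℝ)) (b := 1)).uniformContinuousOn_of_continuous
      φ.continuous.continuousOn) (ε / 2) (half_pos hε)
  obtain ⟨N, hN⟩ := exists_nat_one_div_lt hδ
  refine ⟨N, fun n hn => ?_⟩
  have hn0 : (0 : ℝ) < n + 1 := by positivity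
  have hnδ : ((n : ℝ) + 1)⁻¹ < δ := by
    rw [inv_eq_one_div]
    exact (one_div_le_one_div_of_le (by positivity) (by gcongr)).trans_lt hN
  have hint : ∀ a b, IntervalIntegrable φ volume a b :=
    fun a b => φ.continuous.intervalIntegrable a b
  have hsplit : ∫ x in (0 : ℝ)..1, φ x =
      ∑ i : Fin (n + 1), ∫ x in (i.1 / (n + 1) : ℝ)..gridPt n i, φ x := by
    have := intervalIntegral.sum_integral_adjacent_intervals (μ := volume) (f := φ)
      (a := fun k : ℕ => (k : ℝ) / (n + 1)) (n := n + 1) fun k _ => hint _ _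
    rw [Finset.sum_range] at this
    simp only [Nat.cast_zero, zero_div, Nat.cast_add, Nat.cast_one, div_self hn0.ne'] at this
    exact this.symm
  have hpiece : ∀ i : Fin (n + 1),
      |(n + 1 : ℝ)⁻¹ * φ (gridPt n i) - ∫ x in (i.1 / (n + 1) : ℝ)..gridPt n i, φ x|
        ≤ ε / 2 * (n + 1 : ℝ)⁻¹ := by
    intro i
    have hlen : gridPt n i - i.1 / (n + 1) = (n + 1 : ℝ)⁻¹ := by
      unfold gridPt; field_simp; ring
    have hle : (i.1 / (n + 1) : ℝ) ≤ gridPt n i := by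
      linarith [inv_pos.2 hn0]
    have hconst : (n + 1 : ℝ)⁻¹ * φ (gridPt n i) =
        ∫ _ in (i.1 / (n + 1) : ℝ)..gridPt n i, φ (gridPt n i) := by
      rw [intervalIntegral.integral_const, hlen, smul_eq_mul]
    rw [hconst, ← intervalIntegral.integral_sub (by simp) (hint _ _)]
    have := intervalIntegral.norm_integral_le_of_norm_le_const (a := (i.1 / (n + 1) : ℝ))
      (b := gridPt n i) (f := fun x => φ (gridPt n i) - φ x) (C := ε / 2) ?_
    · rwa [hlen, abs_of_pos (inv_pos.2 hn0)] at this
    intro x hx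
    rw [Set.uIoc_of_le hle] at hx
    have h0 : (0 : ℝ) ≤ i.1 / (n + 1) := by positivity
    rw [Real.norm_eq_abs, ← Real.dist_eq]
    refine (hu _ (gridPt_mem n i) x ⟨h0.trans hx.1.le, hx.2.trans (gridPt_mem n i).2⟩ ?_).le
    rw [Real.dist_eq, abs_of_nonneg (by linarith [hx.2])]
    linarith [hx.1]
  rw [Real.dist_eq, hsplit, Finset.mul_sum, ← Finset.sum_sub_distrib]
  refine ((Finset.abs_sum_le_sum_abs _ _).trans (Finset.sum_le_sum fun i _ => hpiece i)).trans_lt ?_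
  rw [Finset.sum_const, Finset.card_univ, Fintype.card_fin, nsmul_eq_mul]
  push_cast
  field_simp
  linarith

/-- The empirical measure of a permutation. -/
def empMeas (n : ℕ) (π : Equiv.Perm (Fin (n + 1))) : Measure (ℝ × ℝ) :=
  ((n : ℝ≥0∞) + 1)⁻¹ • ∑ i, Measure.dirac (gridPt n i, gridPt n (π i))

instance (n : ℕ) (π : Equiv.Perm (Fin (n + 1))) : IsProbabilityMeasure (empMeas n π) := by
  refine ⟨?_⟩
  simp only [empMeas, Measure.smul_apply, Measure.coe_finsetSum, Finset.sum_apply, measure_univ,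
    Finset.sum_const, Finset.card_univ, Fintype.card_fin, nsmul_eq_mul, mul_one, smul_eq_mul]
  push_cast
  exact ENNReal.inv_mul_cancel (by simp) (by finiteness)

lemma integral_empMeas (n : ℕ) (π : Equiv.Perm (Fin (n + 1))) (g : ℝ × ℝ → ℝ) :
    ∫ p, g p ∂(empMeas n π) = ((n : ℝ) + 1)⁻¹ * ∑ i, g (gridPt n i, gridPt n (π i)) := by
  rw [empMeas, integral_smul_measure, integral_finsetSum_measure]
  · simp only [integral_dirac]
    rw [ENNReal.toReal_inv, ENNReal.toReal_add (by finiteness) (by finiteness)]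
    simp
  · exact fun i _ => integrable_dirac (by simp)

lemma empMeas_compl_unitSq (n : ℕ) (π : Equiv.Perm (Fin (n + 1))) :
    empMeas n π unitSqᶜ = 0 := by
  have : ∀ i, (gridPt n i, gridPt n (π i)) ∈ unitSq := fun i => ⟨gridPt_mem n i, gridPt_mem n _⟩
  simp [empMeas, Measure.dirac_apply' _ measurableSet_unitSq.compl, this]

lemma permStat_succ (f : ℝ × ℝ → ℝ) (n : ℕ) (π : Equiv.Perm (Fin (n + 1))) :
    permStat f (n + 1) π = ∑ i, f (gridPt n i, gridPt n (π i)) := by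
  simp [permStat, gridPt]

/-- The mass of `π` under the Gibbs distribution. -/
def gibbsWeight (f : ℝ × ℝ → ℝ) (t : ℝ) (n : ℕ) (π : Equiv.Perm (Fin n)) : ℝ :=
  Real.exp (t * permStat f n π - Zn f t n)

lemma gibbsWeight_eq (f : ℝ × ℝ → ℝ) (t : ℝ) (n : ℕ) (π : Equiv.Perm (Fin n)) :
    gibbsWeight f t n π = Real.exp (t * permStat f n π) /
      ∑ σ : Equiv.Perm (Fin n), Real.exp (t * permStat f n σ) := by
  rw [gibbsWeight, Zn, Real.exp_sub, Real.exp_log]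
  exact Finset.sum_pos (fun _ _ => Real.exp_pos _) Finset.univ_nonempty

lemma gibbsWeight_nonneg (f : ℝ × ℝ → ℝ) (t : ℝ) (n : ℕ) (π : Equiv.Perm (Fin n)) :
    0 ≤ gibbsWeight f t n π := (Real.exp_pos _).le

lemma sum_gibbsWeight (f : ℝ × ℝ → ℝ) (t : ℝ) (n : ℕ) : ∑ π, gibbsWeight f t n π = 1 := by
  simp only [gibbsWeight_eq, ← Finset.sum_div]
  exact div_self (Finset.sum_pos (fun _ _ => Real.exp_pos _) Finset.univ_nonempty).ne'

section Qprob

variable {f : ℝ × ℝ → ℝ} {t : ℝ} {n : ℕ} {p q : Equiv.Perm (Fin n) → Prop}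

lemma Qprob_nonneg : 0 ≤ Qprob f t n p := by
  classical
  unfold Qprob
  exact Finset.sum_nonneg fun π _ => by split_ifs <;> positivity

lemma Qprob_le_sum {X : Equiv.Perm (Fin n) → ℝ} (h0 : ∀ π, 0 ≤ X π) (h1 : ∀ π, p π → 1 ≤ X π) :
    Qprob f t n p ≤ ∑ π, gibbsWeight f t n π * X π := by
  classical
  unfold Qprob
  refine Finset.sum_le_sum fun π _ => ?_
  have h2 := gibbsWeight_nonneg f t n π
  split_ifs with h
  · exact le_mul_of_one_le_right h2 (h1 π h)
  · exact mul_nonneg h2 (h0 π)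

lemma Qprob_mono (h : ∀ π, p π → q π) : Qprob f t n p ≤ Qprob f t n q := by
  classical
  unfold Qprob
  refine Finset.sum_le_sum fun π _ => ?_
  by_cases hp : p π
  · rw [if_pos hp, if_pos (h π hp)]
  · rw [if_neg hp]
    split_ifs <;> positivity

lemma Qprob_or_le : Qprob f t n (fun π => p π ∨ q π) ≤ Qprob f t n p + Qprob f t n q := by
  classical
  unfold Qprob
  rw [← Finset.sum_add_distrib]
  refine Finset.sum_le_sum fun π _ => ?_
  have := (Real.exp_pos (t * permStat f n π - Zn f t n)).le
  by_cases hp : p π <;> by_cases hq : q π <;> (simp [hp, hq]; try positivity)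

lemma Qprob_true : Qprob f t n (fun _ => True) = 1 := by
  rw [← sum_gibbsWeight f t n]
  simp [Qprob, gibbsWeight]

lemma Qprob_false : Qprob f t n (fun _ => False) = 0 := by
  simp [Qprob]

end Qprob

/-- The empirical measure of a permutation, as a probability measure. -/
def empPM (n : ℕ) (π : Equiv.Perm (Fin (n + 1))) : ProbabilityMeasure (ℝ × ℝ) :=
  ⟨empMeas n π, inferInstance⟩

/-- Continuous functionals of the empirical measure that vanish asymptotically in `L²` under the
Gibbs distribution. -/
def IsAsympNull (f : ℝ × ℝ → ℝ) (t : ℝ) (Ψ : ProbabilityMeasure (ℝ × ℝ) → ℝ) : Prop :=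
  Continuous Ψ ∧ Tendsto (fun n : ℕ =>
    ∑ π, gibbsWeight f t (n + 1) π * Ψ (empPM n π) ^ 2) atTop (𝓝 0)

lemma tendsto_Qprob_empPM_of_isCompact {f : ℝ × ℝ → ℝ} {t : ℝ}
    {K : Set (ProbabilityMeasure (ℝ × ℝ))} (hK : IsCompact K)
    (h : ∀ ν ∈ K, ∃ Ψ, IsAsympNull f t Ψ ∧ Ψ ν ≠ 0) :
    Tendsto (fun n : ℕ => Qprob f t (n + 1) fun π => empPM n π ∈ K) atTop (𝓝 0) := by
  refine hK.induction_on
    (p := fun s => Tendsto (fun n : ℕ => Qprob f t (n + 1) fun π => empPM n π ∈ s) atTop (𝓝 0))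
    ?_ ?_ ?_ ?_
  · simp [Qprob_false]
  · exact fun s s' hs hs' => squeeze_zero (fun _ => Qprob_nonneg)
      (fun _ => Qprob_mono fun _ hπ => hs hπ) hs'
  · intro s s' hs hs'
    refine squeeze_zero (fun _ => Qprob_nonneg) (fun _ => Qprob_or_le) ?_
    simpa using hs.add hs'
  · intro ν hν
    obtain ⟨Ψ, ⟨hc, hΨ⟩, h0⟩ := h ν hν
    have hpos : 0 < Ψ ν ^ 2 := by positivity
    refine ⟨{ρ | Ψ ν ^ 2 / 2 < Ψ ρ ^ 2}, mem_nhdsWithin_of_mem_nhds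
      ((isOpen_lt continuous_const (hc.pow 2)).mem_nhds (half_lt_self hpos)), ?_⟩
    refine squeeze_zero (fun _ => Qprob_nonneg) (fun n => Qprob_le_sum
      (X := fun π => 2 / Ψ ν ^ 2 * Ψ (empPM n π) ^ 2) (fun π => by positivity) ?_)
      (g := fun n : ℕ => ∑ π, gibbsWeight f t (n + 1) π * (2 / Ψ ν ^ 2 * Ψ (empPM n π) ^ 2)) ?_
    · intro π hπ
      have hπ : Ψ ν ^ 2 / 2 < Ψ (empPM n π) ^ 2 := hπ
      rw [div_mul_eq_mul_div, le_div_iff₀ hpos]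
      linarith
    · have := hΨ.const_mul (2 / Ψ ν ^ 2)
      rw [mul_zero] at this
      refine this.congr fun n => ?_
      rw [Finset.mul_sum]
      exact Finset.sum_congr rfl fun π _ => by ring

/-- The bounded continuous function `p ↦ φ p.1`. -/
def bcfFst (φ : ℝ →ᵇ ℝ) : (ℝ × ℝ) →ᵇ ℝ := φ.compContinuous ⟨Prod.fst, continuous_fst⟩

/-- The bounded continuous function `p ↦ φ p.2`. -/
def bcfSnd (φ : ℝ →ᵇ ℝ) : (ℝ × ℝ) →ᵇ ℝ := φ.compContinuous ⟨Prod.snd, continuous_snd⟩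

/-- The bounded continuous function `p ↦ exp (-G p)`. -/
def bcfExpNeg (G : (ℝ × ℝ) →ᵇ ℝ) : (ℝ × ℝ) →ᵇ ℝ :=
  BoundedContinuousFunction.ofNormedAddCommGroup (fun p => Real.exp (-G p))
    (Real.continuous_exp.comp G.continuous.neg) (Real.exp ‖G‖) fun p => by
      rw [Real.norm_eq_abs, Real.abs_exp, Real.exp_le_exp]
      exact (neg_le_abs _).trans (G.norm_coe_le_norm p)

lemma isAsympNull_of_tendsto {f : ℝ × ℝ → ℝ} {t : ℝ} {Ψ : ProbabilityMeasure (ℝ × ℝ) → ℝ}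
    (hc : Continuous Ψ) {c : ℕ → ℝ} (h : ∀ n π, Ψ (empPM n π) = c n)
    (hlim : Tendsto c atTop (𝓝 0)) : IsAsympNull f t Ψ := by
  refine ⟨hc, ?_⟩
  have := hlim.pow 2
  rw [zero_pow two_ne_zero] at this
  refine this.congr fun n => ?_
  simp only [h, ← Finset.sum_mul, sum_gibbsWeight, one_mul]

lemma isAsympNull_fst (f : ℝ × ℝ → ℝ) (t : ℝ) (φ : ℝ →ᵇ ℝ) :
    IsAsympNull f t fun ν => ∫ p, bcfFst φ p ∂(ν : Measure (ℝ × ℝ)) - ∫ x, φ x ∂unif01 := by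
  refine isAsympNull_of_tendsto
    ((ProbabilityMeasure.continuous_integral_boundedContinuousFunction _).sub continuous_const)
    (c := fun n => ((n : ℝ) + 1)⁻¹ * ∑ i, φ (gridPt n i) - ∫ x, φ x ∂unif01) (fun n π => ?_) ?_
  · exact congrArg (· - _) (integral_empMeas n π _)
  · simpa using (tendsto_average_gridPt φ).sub_const (∫ x, φ x ∂unif01)

lemma isAsympNull_snd (f : ℝ × ℝ → ℝ) (t : ℝ) (φ : ℝ →ᵇ ℝ) :
    IsAsympNull f t fun ν => ∫ p, bcfSnd φ p ∂(ν : Measure (ℝ × ℝ)) - ∫ x, φ x ∂unif01 := by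
  refine isAsympNull_of_tendsto
    ((ProbabilityMeasure.continuous_integral_boundedContinuousFunction _).sub continuous_const)
    (c := fun n => ((n : ℝ) + 1)⁻¹ * ∑ i, φ (gridPt n i) - ∫ x, φ x ∂unif01) (fun n π => ?_) ?_
  · rw [← Equiv.sum_comp π fun i => φ (gridPt n i)]
    exact congrArg (· - _) (integral_empMeas n π _)
  · simpa using (tendsto_average_gridPt φ).sub_const (∫ x, φ x ∂unif01)

/-- The factorization defect of a measure. -/
def factorDefect (E : (ℝ × ℝ) →ᵇ ℝ) (φ ψ : ℝ →ᵇ ℝ) (ν : ProbabilityMeasure (ℝ × ℝ)) : ℝ :=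
  (∫ p, (E * (bcfFst φ * bcfSnd ψ)) p ∂(ν : Measure (ℝ × ℝ))) *
      ∫ p, E p ∂(ν : Measure (ℝ × ℝ))
    - (∫ p, (E * bcfFst φ) p ∂(ν : Measure (ℝ × ℝ))) *
      ∫ p, (E * bcfSnd ψ) p ∂(ν : Measure (ℝ × ℝ))

lemma factorDefect_empPM (E : (ℝ × ℝ) →ᵇ ℝ) (φ ψ : ℝ →ᵇ ℝ) (n : ℕ)
    (π : Equiv.Perm (Fin (n + 1))) :
    factorDefect E φ ψ (empPM n π) = ((n : ℝ) + 1)⁻¹ ^ 2 *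
      swapDefect (fun i j => E (gridPt n i, gridPt n j)) (fun i => φ (gridPt n i))
        (fun i => ψ (gridPt n i)) π := by
  have h := integral_empMeas n π
  change (∫ p, _ ∂(empMeas n π)) * (∫ p, _ ∂(empMeas n π)) -
    (∫ p, _ ∂(empMeas n π)) * (∫ p, _ ∂(empMeas n π)) = _
  rw [h, h, h, h, swapDefect]
  simp only [BoundedContinuousFunction.coe_mul, Pi.mul_apply, bcfFst, bcfSnd,
    BoundedContinuousFunction.compContinuous_apply, ContinuousMap.coe_mk]
  ring

lemma isAsympNull_factorDefect {f : ℝ × ℝ → ℝ} {F : (ℝ × ℝ) →ᵇ ℝ}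
    (hfF : Set.EqOn f F unitSq) (t : ℝ) (φ ψ : ℝ →ᵇ ℝ) :
    IsAsympNull f t (factorDefect (bcfExpNeg (t • F)) φ ψ) := by
  have hcont : ∀ g : (ℝ × ℝ) →ᵇ ℝ,
      Continuous fun ν : ProbabilityMeasure (ℝ × ℝ) => ∫ p, g p ∂(ν : Measure (ℝ × ℝ)) :=
    fun g => ProbabilityMeasure.continuous_integral_boundedContinuousFunction g
  refine ⟨((hcont _).mul (hcont _)).sub ((hcont _).mul (hcont _)), ?_⟩
  obtain ⟨M, hM1, hMe, hMφ, hMψ⟩ : ∃ M : ℝ, 1 ≤ M ∧ Real.exp ‖t • F‖ ≤ M ∧ ‖φ‖ ≤ M ∧ ‖ψ‖ ≤ M :=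
    ⟨max (max 1 (Real.exp ‖t • F‖)) (max ‖φ‖ ‖ψ‖), by simp, by simp, by simp, by simp⟩
  have hbound : ∀ n : ℕ, ∑ π, gibbsWeight f t (n + 1) π *
      factorDefect (bcfExpNeg (t • F)) φ ψ (empPM n π) ^ 2 ≤
        16 * M ^ 10 * (1 / ((n : ℝ) + 1)) := by
    intro n
    let g : Fin (n + 1) → Fin (n + 1) → ℝ := fun i j => (t • F) (gridPt n i, gridPt n j)
    have hw : ∀ π, t * permStat f (n + 1) π = ∑ k, g k (π k) := by
      intro π
      rw [permStat_succ, Finset.mul_sum]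
      refine Finset.sum_congr rfl fun k _ => ?_
      rw [hfF ⟨gridPt_mem n k, gridPt_mem n (π k)⟩]
      rfl
    have hS : 0 < ∑ π : Equiv.Perm (Fin (n + 1)), Real.exp (∑ k, g k (π k)) :=
      Finset.sum_pos (fun _ _ => Real.exp_pos _) Finset.univ_nonempty
    have key := sum_exp_mul_swapDefect_sq_le g (φ := fun i => φ (gridPt n i))
      (ψ := fun i => ψ (gridPt n i)) hM1
      (fun i j => (Real.exp_le_exp.2 ((neg_le_abs _).trans ((t • F).norm_coe_le_norm _))).trans hMe)
      (fun i => (φ.norm_coe_le_norm _).trans hMφ) (fun i => (ψ.norm_coe_le_norm _).trans hMψ)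
    rw [← div_le_iff₀ hS, Finset.sum_div] at key
    have hn : (0 : ℝ) < n + 1 := by positivity
    calc _ = ((n : ℝ) + 1)⁻¹ ^ 4 * ∑ π : Equiv.Perm (Fin (n + 1)),
            Real.exp (∑ k, g k (π k)) * swapDefect (fun i j => Real.exp (-g i j))
              (fun i => φ (gridPt n i)) (fun i => ψ (gridPt n i)) π ^ 2 /
              ∑ σ : Equiv.Perm (Fin (n + 1)), Real.exp (∑ k, g k (σ k)) := by
          rw [Finset.mul_sum]
          refine Finset.sum_congr rfl fun π _ => ?_
          simp only [gibbsWeight_eq, hw, factorDefect_empPM]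
          change _ / _ * (_ * swapDefect (fun i j => Real.exp (-g i j)) _ _ _) ^ 2 = _
          ring
      _ ≤ ((n : ℝ) + 1)⁻¹ ^ 4 * (16 * M ^ 10 * ((n : ℝ) + 1) ^ 3) := by
          gcongr
          simpa using key
      _ = _ := by field_simp
  refine squeeze_zero (fun n => Finset.sum_nonneg fun π _ =>
    mul_nonneg (gibbsWeight_nonneg _ _ _ _) (sq_nonneg _)) hbound ?_
  simpa using (tendsto_one_div_add_atTop_nhds_zero_nat (𝕜 := ℝ)).const_mul (16 * M ^ 10)

/-- A measure on the square on which all asymptotically null functionals vanish is a Gibbs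
measure with uniform marginals. -/
lemma mem_MM_and_isGibbs_of_isAsympNull {f : ℝ × ℝ → ℝ} {F : (ℝ × ℝ) →ᵇ ℝ}
    (hfF : Set.EqOn f F unitSq) {t : ℝ} {ν : ProbabilityMeasure (ℝ × ℝ)}
    (h : ∀ Ψ, IsAsympNull f t Ψ → Ψ ν = 0) :
    (ν : Measure (ℝ × ℝ)) ∈ MM ∧ IsGibbs (t • F) (ν : Measure (ℝ × ℝ)) := by
  have hMM : (ν : Measure (ℝ × ℝ)) ∈ MM := by
    refine ⟨inferInstance, ?_, ?_⟩
    · have := Measure.isProbabilityMeasure_map (μ := (ν : Measure (ℝ × ℝ)))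
        measurable_fst.aemeasurable
      refine ext_of_forall_integral_eq_of_IsFiniteMeasure fun φ => ?_
      rw [integral_map measurable_fst.aemeasurable φ.continuous.aestronglyMeasurable]
      exact sub_eq_zero.1 (h _ (isAsympNull_fst f t φ))
    · have := Measure.isProbabilityMeasure_map (μ := (ν : Measure (ℝ × ℝ)))
        measurable_snd.aemeasurable
      refine ext_of_forall_integral_eq_of_IsFiniteMeasure fun φ => ?_
      rw [integral_map measurable_snd.aemeasurable φ.continuous.aestronglyMeasurable]
      exact sub_eq_zero.1 (h _ (isAsympNull_snd f t φ))
  exact ⟨hMM, isGibbs_of_factorization _ hMM fun φ ψ =>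
    sub_eq_zero.1 (h _ (isAsympNull_factorDefect hfF t φ ψ))⟩

/-- The probability measures concentrated on the unit square. -/
def squarePM : Set (ProbabilityMeasure (ℝ × ℝ)) := {ν | (ν : Measure (ℝ × ℝ)) unitSqᶜ = 0}

lemma isCompact_squarePM : IsCompact squarePM := by
  have := isCompact_setOfPred_probabilityMeasure_mass_eq_compl_isCompact_le
    (E := ℝ × ℝ) (u := fun _ => 0) (K := fun _ => unitSq) tendsto_const_nhds
    (fun _ => isCompact_unitSq) (Or.inl inferInstance)
  convert this using 1
  ext ν
  simp [squarePM, ProbabilityMeasure.null_iff_toMeasure_null]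

lemma empPM_mem_squarePM (n : ℕ) (π : Equiv.Perm (Fin (n + 1))) : empPM n π ∈ squarePM :=
  empMeas_compl_unitSq n π

lemma isGibbs_maximizer {f : ℝ × ℝ → ℝ} {F : (ℝ × ℝ) →ᵇ ℝ} (hfF : Set.EqOn f F unitSq)
    {μf : ℝ → Measure (ℝ × ℝ)}
    (hμf : ∀ t : ℝ, μf t ∈ MM ∧ ∀ ν ∈ MM, objE f t ν ≤ objE f t (μf t)) (t : ℝ) :
    IsGibbs (t • F) (μf t) := by
  obtain ⟨ν, -, hν⟩ : ∃ ν ∈ squarePM, ∀ Ψ, IsAsympNull f t Ψ → Ψ ν = 0 := by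
    by_contra! hcon
    have h := tendsto_Qprob_empPM_of_isCompact isCompact_squarePM hcon
    simp only [empPM_mem_squarePM, Qprob_true] at h
    exact one_ne_zero (tendsto_nhds_unique tendsto_const_nhds h)
  obtain ⟨hMM, hG⟩ := mem_MM_and_isGibbs_of_isAsympNull hfF hν
  exact hG.eq_of_objE_le hfF hMM (hμf t).1 ((hμf t).2 _ hMM) ▸ hG

/-- The law of large numbers for the sufficient statistic under the Gibbs distribution. -/
lemma tendsto_Qprob_abs_sub_ge {f : ℝ × ℝ → ℝ} {F : (ℝ × ℝ) →ᵇ ℝ} (hfF : Set.EqOn f F unitSq)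
    {μf : ℝ → Measure (ℝ × ℝ)}
    (hμf : ∀ t : ℝ, μf t ∈ MM ∧ ∀ ν ∈ MM, objE f t ν ≤ objE f t (μf t)) (t : ℝ) {ε : ℝ}
    (hε : 0 < ε) :
    Tendsto (fun n : ℕ => Qprob f t n fun π => ε ≤ |permStat f n π / n - ∫ p, f p ∂(μf t)|)
      atTop (𝓝 0) := by
  rw [← tendsto_add_atTop_iff_nat 1]
  have hc : Continuous fun ν : ProbabilityMeasure (ℝ × ℝ) => ∫ p, F p ∂(ν : Measure (ℝ × ℝ)) :=
    ProbabilityMeasure.continuous_integral_boundedContinuousFunction F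
  have hK : IsCompact (squarePM ∩
      {ν | ε ≤ |∫ p, F p ∂(ν : Measure (ℝ × ℝ)) - ∫ p, F p ∂(μf t)|}) :=
    isCompact_squarePM.inter_right (isClosed_le continuous_const (hc.sub continuous_const).abs)
  refine (tendsto_Qprob_empPM_of_isCompact (f := f) (t := t) hK ?_).congr fun n => ?_
  · rintro ν ⟨-, hν⟩
    by_contra! hcon
    obtain ⟨hMM, hG⟩ := mem_MM_and_isGibbs_of_isAsympNull hfF hcon
    have hν : ε ≤ |∫ p, F p ∂(ν : Measure (ℝ × ℝ)) - ∫ p, F p ∂(μf t)| := hν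
    rw [hG.eq_of_objE_le hfF hMM (hμf t).1 ((hμf t).2 _ hMM), sub_self, abs_zero] at hν
    exact hε.not_ge hν
  · congr 1
    ext π
    have h1 : ∫ p, F p ∂(empPM n π : Measure (ℝ × ℝ)) = permStat f (n + 1) π / (n + 1 : ℕ) := by
      rw [permStat_succ, div_eq_inv_mul, Nat.cast_succ]
      refine (integral_empMeas n π _).trans ?_
      congr 1
      exact Finset.sum_congr rfl fun i _ => (hfF ⟨gridPt_mem n i, gridPt_mem n (π i)⟩).symm
    simp only [Set.mem_inter_iff, empPM_mem_squarePM, true_and, Set.mem_ofPred_eq, h1,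
      integral_eq_of_eqOn_unitSq hfF (hμf t).1]

lemma exists_bcf_eqOn_unitSq {f : ℝ × ℝ → ℝ} (hf : ContinuousOn f unitSq) :
    ∃ F : (ℝ × ℝ) →ᵇ ℝ, Set.EqOn f F unitSq := by
  obtain ⟨C, hC⟩ := isCompact_unitSq.exists_bound_of_continuousOn hf
  let c : ℝ × ℝ → ℝ × ℝ := fun p => (max 0 (min p.1 1), max 0 (min p.2 1))
  have hc : ∀ p, c p ∈ unitSq := fun p => by simp [c, unitSq]
  have hcc : Continuous c := by fun_prop
  refine ⟨.ofNormedAddCommGroup (f ∘ c) (hf.comp_continuous hcc hc) C fun p => hC _ (hc p), ?_⟩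
  rintro ⟨x, y⟩ ⟨⟨hx0, hx1⟩, hy0, hy1⟩
  have : c (x, y) = (x, y) := by simp_all [c]
  simp [this]

/-- The test based on the root of `LD_n` is consistent for testing
`θ = θ₀` against `θ = θ₁ > θ₀`. Here `μf t` denotes the unique maximizer of
`μ ↦ t μ[f] − D(μ‖u)` over `𝓜`. -/
theorem LD_test_consistent (f : ℝ × ℝ → ℝ) (hf : memC f) (θ₀ θ₁ : ℝ) (h01 : θ₀ < θ₁)
    (μf : ℝ → Measure (ℝ × ℝ))
    (hμf : ∀ t : ℝ, μf t ∈ MM ∧ ∀ ν ∈ MM, objE f t ν ≤ objE f t (μf t)) :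
    Tendsto (fun n : ℕ => Qprob f θ₀ n
        (fun π => ∃ t : ℝ, permStat f n π / n - ∫ p, f p ∂(μf t) = 0 ∧ (θ₀ + θ₁) / 2 < t))
      atTop (𝓝 0) ∧
    Tendsto (fun n : ℕ => Qprob f θ₁ n
        (fun π => ∃ t : ℝ, permStat f n π / n - ∫ p, f p ∂(μf t) = 0 ∧ t ≤ (θ₀ + θ₁) / 2))
      atTop (𝓝 0) := by
  obtain ⟨F, hfF⟩ := exists_bcf_eqOn_unitSq hf.1
  have hmono := strictMono_integral_maximizer hf hfF hμf (isGibbs_maximizer hfF hμf)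
  have h0 := hmono (show θ₀ < (θ₀ + θ₁) / 2 by linarith)
  have h1 := hmono (show (θ₀ + θ₁) / 2 < θ₁ by linarith)
  constructor
  · refine squeeze_zero (fun _ => Qprob_nonneg) (fun n => Qprob_mono ?_)
      (tendsto_Qprob_abs_sub_ge hfF hμf θ₀ (sub_pos.2 h0))
    rintro π ⟨t, ht, hlt⟩
    have := hmono hlt
    refine le_trans ?_ (le_abs_self _)
    dsimp only at this ⊢
    linarith
  · refine squeeze_zero (fun _ => Qprob_nonneg) (fun n => Qprob_mono ?_)
      (tendsto_Qprob_abs_sub_ge hfF hμf θ₁ (sub_pos.2 h1))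
    rintro π ⟨t, ht, hle⟩
    have := hmono.monotone hle
    refine le_trans ?_ (neg_le_abs _)
    dsimp only at this ⊢
    linarith
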